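/- The language K = (a·c*·b + c)* over A₃ is not recognized by any Σ₂ circuit family. -/

import Mathlib

/-- A predicate on words (functions `ι → A`) is `k`-local if its value is
determined by the letters at some fixed set of at most `k` positions. -/
def KLocal {ι A : Type*} (k : ℕ) (g : (ι → A) → Prop) : Prop :=
  ∃ P : Finset ι, P.card ≤ k ∧ ∀ w v : ι → A, (∀ p ∈ P, w p = v p) → (g w ↔ g v)

/-- An `(s,k)`-Σ₂-circuit: an OR of at most `s` ANDs of `k`-local predicates. -/
def Sigma2Circuit {ι A : Type*} (s k : ℕ) (C : (ι → A) → Prop) : Prop :=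
  ∃ s' : ℕ, s' ≤ s ∧ ∃ J : Fin s' → Type, ∃ g : ∀ i : Fin s', J i → ((ι → A) → Prop),
    (∀ i j, KLocal k (g i j)) ∧ ∀ w, C w ↔ ∃ i, ∀ j, g i j w

/-- `u` is a `k`-limit for `F`: any `k` positions of `u` are matched by some word of `F`. -/
def KLimit {ι A : Type*} (k : ℕ) (F : Set (ι → A)) (u : ι → A) : Prop :=
  ∀ P : Finset ι, P.card ≤ k → ∃ v ∈ F, ∀ p ∈ P, u p = v p

/-- A language is recognized by a Σ₂ circuit family:
polynomial-size Σ₂ circuits with constant top fan-in (locality). -/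
def RecSigma2 {A : Type*} (L : Language A) : Prop :=
  ∃ k c d : ℕ, ∀ n : ℕ, ∃ C : (Fin n → A) → Prop,
    Sigma2Circuit (c * (n + 1) ^ d) k C ∧ ∀ w : Fin n → A, C w ↔ List.ofFn w ∈ L

/-- The three-letter alphabet, with letters `la = a`, `lb = b`, `lc = c` (the neutral letter). -/
abbrev A₃ : Type := Fin 3
def la : A₃ := 0
def lb : A₃ := 1
def lc : A₃ := 2

open RegularExpression in
/-- The regular expression `(a·c*·b + c)*`. -/
def Kexp : RegularExpression A₃ :=
  (char la * (char lc).star * char lb + char lc).star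

/-- The language `K = (a·c*·b + c)*`. -/
def Klang : Language A₃ := Kexp.matches'

open Computability RegularExpression in
theorem mem_Klang_iff {l : List A₃} :
    l ∈ Klang ↔ l ∈ (({[la]} * {[lc]}∗ * {[lb]} + {[lc]} : Language A₃))∗ := by
  rw [Klang, Kexp, matches'_star, matches'_add, matches'_mul, matches'_mul, matches'_star,
    matches'_char, matches'_char, matches'_char]

theorem append_mem_Klang {l l' : List A₃} (h : l ∈ Klang) (h' : l' ∈ Klang) :
    l ++ l' ∈ Klang := by
  rw [mem_Klang_iff] at *
  have := Language.append_mem_mul h h'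
  rwa [kstar_mul_kstar] at this

open Computability in
theorem flatten_mem_Klang {L : List (List A₃)} (h : ∀ l ∈ L, l ∈ Klang) :
    L.flatten ∈ Klang := by
  have : L.flatten ∈ Klang∗ := Language.join_mem_kstar h
  have hK : Klang∗ = Klang := kstar_idem _
  rwa [hK] at this

open Computability in
theorem replicate_mem_kstar {A : Type*} (x : A) (n : ℕ) :
    List.replicate n x ∈ ({[x]} : Language A)∗ := by
  rw [Language.mem_kstar]
  refine ⟨List.replicate n [x], by simp, fun y hy => ?_⟩
  exact List.eq_of_mem_replicate hy

theorem replicate_mem_Klang (n : ℕ) : List.replicate n lc ∈ Klang := by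
  rw [mem_Klang_iff, Language.mem_kstar]
  refine ⟨List.replicate n [lc], by simp, fun y hy => ?_⟩
  exact Or.inr (List.eq_of_mem_replicate hy)

open Computability in
theorem pair_mem_Klang (n : ℕ) : [la] ++ List.replicate n lc ++ [lb] ∈ Klang := by
  rw [mem_Klang_iff]
  refine (le_kstar : _ ≤ (({[la]} * {[lc]}∗ * {[lb]} + {[lc]} : Language A₃))∗) (Or.inl ?_)
  exact Language.append_mem_mul (Language.append_mem_mul rfl (replicate_mem_kstar _ _)) rfl

/-- The number of non-neutral letters of a word. -/
def weight (l : List A₃) : ℕ := (l.map fun x => if x = lc then 0 else 1).sum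

theorem weight_append (l l' : List A₃) : weight (l ++ l') = weight l + weight l' := by
  simp [weight]

theorem even_weight_flatten {L : List (List A₃)} (h : ∀ l ∈ L, Even (weight l)) :
    Even (weight L.flatten) := by
  induction L with
  | nil => simp [weight]
  | cons l L ih =>
    rw [List.flatten_cons, weight_append]
    exact (h l (by simp)).add (ih fun l' hl' => h l' (by simp [hl']))

theorem even_weight_of_mem_Klang {l : List A₃} (h : l ∈ Klang) : Even (weight l) := by
  rw [mem_Klang_iff, Language.mem_kstar] at h
  obtain ⟨L, rfl, hL⟩ := h
  refine even_weight_flatten fun l hl => ?_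
  rcases hL l hl with h | h
  · obtain ⟨_, ⟨_, rfl, v, hv, rfl⟩, _, rfl, rfl⟩ := h
    obtain ⟨M, rfl, hM⟩ := Language.mem_kstar.1 hv
    have hc : Even (weight M.flatten) := even_weight_flatten fun y hy => by
      rw [show y = [lc] from hM y hy]
      simp [weight]
    simp only [weight_append]
    have ha : weight [la] = 1 := rfl
    have hb : weight [lb] = 1 := rfl
    rw [ha, hb, Nat.even_iff] at *
    omega
  · rw [show l = [lc] from h]
    simp [weight]

theorem weight_ofFn {n : ℕ} (w : Fin n → A₃) :
    weight (List.ofFn w) = (Finset.univ.filter fun p => w p ≠ lc).card := by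
  simp [weight, List.map_ofFn, List.sum_ofFn, Finset.card_filter, ite_not]

section BlockWord

variable {ι I J : Type*} [DecidableEq J]

/-- The members of `F` that agree with `f` on `S`. -/
def agreeing (F : Finset (I → J)) (S : Finset I) (f : I → J) : Finset (I → J) :=
  F.filter fun g => ∀ i ∈ S, g i = f i

theorem mem_agreeing {F : Finset (I → J)} {S : Finset I} {f g : I → J} :
    g ∈ agreeing F S f ↔ g ∈ F ∧ ∀ i ∈ S, g i = f i := by
  simp [agreeing]

variable [DecidableEq I]

/-- Positions are pairs (block, place). The word has the letter `x i` at place `f i` of each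
block `i ∈ S`, and is neutral elsewhere. -/
def blockWord (e : ι ≃ I × J) (x : I → A₃) (S : Finset I) (f : I → J) : ι → A₃ := fun p =>
  if (e p).1 ∈ S ∧ f (e p).1 = (e p).2 then x (e p).1 else lc

theorem card_support_blockWord [Fintype ι] (e : ι ≃ I × J) {x : I → A₃} (hx : ∀ i, x i ≠ lc)
    (S : Finset I) (f : I → J) :
    (Finset.univ.filter fun p => blockWord e x S f p ≠ lc).card = S.card := by
  symm
  refine Finset.card_bij (fun i _ => e.symm (i, f i)) ?_ ?_ ?_
  · intro i hi
    simp [blockWord, hi, hx]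
  · intro i _ i' _ h
    simpa using congrArg (fun p => (e p).1) h
  · intro p hp
    have h : (e p).1 ∈ S ∧ f (e p).1 = (e p).2 := by
      by_contra h
      exact (Finset.mem_filter.1 hp).2 (if_neg h)
    exact ⟨(e p).1, h.1, by rw [h.2, Prod.mk.eta, e.symm_apply_apply]⟩

theorem mem_agreeing_insert {F : Finset (I → J)} {S : Finset I} {f g : I → J} {i : I}
    (hi : i ∉ S) (hg : g ∈ agreeing F S f) :
    g ∈ agreeing F (insert i S) (Function.update f i (g i)) := by
  rw [mem_agreeing] at *
  refine ⟨hg.1, fun i' h' => ?_⟩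
  rcases eq_or_ne i' i with rfl | hne
  · simp
  · rw [Function.update_of_ne hne]
    exact hg.2 i' (Finset.mem_of_mem_insert_of_ne h' hne)

/-- If no block word with an odd number of occupied blocks is a `k`-limit of the full block words
coming from `F`, then each two further letters are specified at a cost of `|J| * k`. -/
theorem card_agreeing_le [Fintype I] [Fintype J] (e : ι ≃ I × J) (x : I → A₃)
    {F : Finset (I → J)} {k : ℕ}
    (hF : ∀ (S : Finset I) f, Odd S.card →
      ¬ KLimit k (blockWord e x Finset.univ '' F) (blockWord e x S f))
    (hI : Even (Fintype.card I)) (r : ℕ) (S : Finset I) (f : I → J)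
    (hr : S.card + 2 * r = Fintype.card I) :
    (agreeing F S f).card ≤ (Fintype.card J * k) ^ r := by
  induction r generalizing S f with
  | zero =>
    have hS : S = Finset.univ := Finset.eq_univ_of_card S hr
    rw [pow_zero, Finset.card_le_one]
    intro g hg g' hg'
    rw [mem_agreeing] at hg hg'
    funext i
    rw [hg.2 i (by simp [hS]), hg'.2 i (by simp [hS])]
  | succ r ih =>
    obtain ⟨i, hi⟩ : ∃ i, i ∉ S := by
      by_contra! h
      have := Finset.card_eq_iff_eq_univ S |>.2 (Finset.eq_univ_iff_forall.2 h)
      omega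
    have hcard : (insert i S).card = S.card + 1 := Finset.card_insert_of_notMem hi
    have hodd : ∀ j, (agreeing F (insert i S) (Function.update f i j)).card ≤
        k * (Fintype.card J * k) ^ r := by
      intro j
      generalize Function.update f i j = f'
      have hlim := hF (insert i S) f' (by
        rw [Nat.even_iff] at hI
        rw [Nat.odd_iff]
        omega)
      generalize insert i S = S' at *
      simp only [KLimit, not_forall, not_exists, not_and] at hlim
      obtain ⟨P, hP, hne⟩ := hlim
      let B := (P.filter fun p => (e p).1 ∉ S').biUnion fun p =>
        agreeing F (insert (e p).1 S') (Function.update f' (e p).1 (e p).2)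
      have hsub : agreeing F S' f' ⊆ B := by
        intro g hg
        have hg' := mem_agreeing.1 hg
        obtain ⟨p, hp, hpne⟩ := hne _ ⟨g, hg'.1, rfl⟩
        have hpS : (e p).1 ∉ S' := by
          intro h
          simp [blockWord, h, hg'.2 _ h] at hpne
        have hgp : g (e p).1 = (e p).2 := by
          by_contra h
          simp [blockWord, hpS, h] at hpne
        simp only [B, Finset.mem_biUnion, Finset.mem_filter]
        refine ⟨p, ⟨hp, hpS⟩, ?_⟩
        rw [← hgp]
        exact mem_agreeing_insert hpS hg
      refine (Finset.card_le_card hsub).trans ?_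
      refine (Finset.card_biUnion_le_card_mul _ _ ((Fintype.card J * k) ^ r) ?_).trans ?_
      · intro p hp
        refine ih _ _ ?_
        rw [Finset.card_insert_of_notMem (Finset.mem_filter.1 hp).2]
        omega
      · exact Nat.mul_le_mul_right _ ((Finset.card_filter_le _ _).trans hP)
    have hsub : agreeing F S f ⊆ Finset.univ.biUnion fun j =>
        agreeing F (insert i S) (Function.update f i j) := by
      intro g hg
      simp only [Finset.mem_biUnion, Finset.mem_univ, true_and]
      exact ⟨g i, mem_agreeing_insert hi hg⟩
    calc (agreeing F S f).card ≤ _ := Finset.card_le_card hsub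
      _ ≤ Fintype.card J * (k * (Fintype.card J * k) ^ r) :=
        Finset.card_biUnion_le_card_mul _ _ _ fun j _ => hodd j
      _ = _ := by ring

end BlockWord

/-- A conjunction of `k`-local predicates that holds on `F` holds on all `k`-limits of `F`. -/
theorem KLimit.forall_kLocal {ι A J : Type*} {k : ℕ} {g : J → (ι → A) → Prop}
    (hg : ∀ j, KLocal k (g j)) {F : Set (ι → A)} (hF : ∀ v ∈ F, ∀ j, g j v) {u : ι → A}
    (hu : KLimit k F u) (j : J) : g j u := by
  obtain ⟨P, hP, h⟩ := hg j
  obtain ⟨v, hv, huv⟩ := hu P hP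
  exact (h u v huv).2 (hF v hv j)

theorem ofFn_single {m : ℕ} (q : Fin m) (x : A₃) :
    List.ofFn (fun j => if q = j then x else lc) =
      List.replicate q lc ++ [x] ++ List.replicate (m - 1 - q) lc := by
  apply List.ext_getElem
  · have := q.2
    simp
    omega
  · intro n h₁ h₂
    simp only [List.length_ofFn] at h₁
    simp only [List.getElem_ofFn, Fin.ext_iff]
    rcases lt_trichotomy n q with h | h | h
    · rw [if_neg (by omega)]
      simp [h]
    · simp [h]
    · rw [if_neg (by omega), List.getElem_append_right (by simp; omega)]
      simp

/-- The letter `a` in even blocks and `b` in odd ones. -/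
def altLetter {T : ℕ} (i : Fin T) : A₃ := if i.val % 2 = 0 then la else lb

theorem altLetter_ne {T : ℕ} (i : Fin T) : altLetter i ≠ lc := by
  unfold altLetter
  split_ifs <;> decide

theorem ofFn_blockWord_mem_Klang {t m : ℕ} (f : Fin (t * 2) → Fin m) :
    List.ofFn (blockWord finProdFinEquiv.symm altLetter Finset.univ f) ∈ Klang := by
  have h : List.ofFn (blockWord finProdFinEquiv.symm altLetter Finset.univ f) =
      (List.ofFn fun i => List.ofFn fun j => if f i = j then altLetter i else lc).flatten := by
    rw [List.ofFn_mul]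
    congr 2
    funext i
    congr 1
    funext j
    rw [show (⟨i * m + j, _⟩ : Fin (t * 2 * m)) = finProdFinEquiv (i, j) from
      Fin.ext (by simp; ring)]
    simp [blockWord]
  rw [h, List.ofFn_mul, List.flatten_flatten]
  refine flatten_mem_Klang fun l hl => ?_
  simp only [List.map_ofFn, List.mem_ofFn, Function.comp_apply] at hl
  obtain ⟨i, rfl⟩ := hl
  simp only [ofFn_single]
  have h_block : ∀ p q r s, List.replicate p lc ++ la :: (List.replicate q lc ++
      (List.replicate r lc ++ lb :: List.replicate s lc)) ∈ Klang := by
    intro p q r s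
    rw [← List.append_assoc (List.replicate q lc), List.replicate_append_replicate]
    simpa using append_mem_Klang (append_mem_Klang (replicate_mem_Klang p)
      (pair_mem_Klang (q + r))) (replicate_mem_Klang s)
  simpa [altLetter, List.ofFn_succ] using h_block _ _ _ _

theorem blockWord_notMem_Klang {T m : ℕ} {S : Finset (Fin T)} (hS : Odd S.card)
    (f : Fin T → Fin m) :
    List.ofFn (blockWord finProdFinEquiv.symm altLetter S f) ∉ Klang := by
  intro h
  have := even_weight_of_mem_Klang h
  rw [weight_ofFn, card_support_blockWord _ altLetter_ne] at this
  exact Nat.not_even_iff_odd.2 hS this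

theorem pow_le_of_sigma2Circuit {t m s k : ℕ} {C : (Fin (t * 2 * m) → A₃) → Prop}
    (hC : Sigma2Circuit s k C) (hK : ∀ w, C w ↔ List.ofFn w ∈ Klang) :
    m ^ (t * 2) ≤ s * (m * k) ^ t := by
  classical
  obtain ⟨s', hs, J, g, hg, hCg⟩ := hC
  let F : Fin s' → Finset (Fin (t * 2) → Fin m) := fun i => Finset.univ.filter fun f =>
    ∀ j, g i j (blockWord finProdFinEquiv.symm altLetter Finset.univ f)
  have hcover : Finset.univ ⊆ Finset.univ.biUnion F := by
    intro f _
    obtain ⟨i, hi⟩ := (hCg _).1 ((hK _).2 (ofFn_blockWord_mem_Klang f))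
    simpa [F] using ⟨i, hi⟩
  have hF : ∀ i, (F i).card ≤ (m * k) ^ t := by
    intro i
    rcases (F i).eq_empty_or_nonempty with h | ⟨f, -⟩
    · simp [h]
    have := card_agreeing_le (k := k) finProdFinEquiv.symm altLetter (F := F i) ?_ (by simp) t ∅ f
      (by simp [mul_comm])
    · simpa [agreeing] using this
    · intro S f hS hlim
      refine blockWord_notMem_Klang hS f ((hK _).1 ((hCg _).2 ⟨i, ?_⟩))
      refine hlim.forall_kLocal (hg i) ?_
      rintro _ ⟨f', hf', rfl⟩
      simpa [F] using hf'
  calc m ^ (t * 2) = (Finset.univ : Finset (Fin (t * 2) → Fin m)).card := by simp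
    _ ≤ _ := Finset.card_le_card hcover
    _ ≤ s' * (m * k) ^ t := by
      simpa using Finset.card_biUnion_le_card_mul Finset.univ F _ fun i _ => hF i
    _ ≤ _ := Nat.mul_le_mul_right _ hs

/-- The language `K = (a·c*·b + c)*` is not recognized by any Σ₂ circuit family. -/
theorem K_not_recSigma2 : ¬ RecSigma2 Klang := by
  rintro ⟨k, c, d, h⟩
  obtain ⟨M, hM⟩ : ∃ M, M = c * ((d + 1) * 2 + 1) ^ d * k ^ (d + 1) := ⟨_, rfl⟩
  obtain ⟨m, hm⟩ : ∃ m, m = M + 1 := ⟨_, rfl⟩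
  have hm1 : 1 ≤ m := by omega
  obtain ⟨C, hC, hK⟩ := h ((d + 1) * 2 * m)
  have hle := pow_le_of_sigma2Circuit hC hK
  have hn : (d + 1) * 2 * m + 1 ≤ ((d + 1) * 2 + 1) * m := by
    rw [add_mul _ 1 m]
    omega
  have hbound : m ^ (2 * d + 1) * m ≤ m ^ (2 * d + 1) * M :=
    calc m ^ (2 * d + 1) * m = m ^ ((d + 1) * 2) := by ring
      _ ≤ _ := hle
      _ ≤ c * (((d + 1) * 2 + 1) * m) ^ d * (m * k) ^ (d + 1) := by gcongr
      _ = m ^ (2 * d + 1) * M := by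
        rw [hM, mul_pow, mul_pow]
        ring
  have := Nat.le_of_mul_le_mul_left hbound (by positivity)
  omega
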